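/- Let T_1, …, T_d be bounded operators on H with Σ_{i=1}^d T_i T_i* ≤ I, let Φ_T(a) = Σ_{i=1}^d T_i a T_i* on B(H), and let Ψ(b) = C_T* ∘ b ∘ C_T on B(ℓ²(W_d, H)). Let a ∈ B(H) be positive with Φ_T(a) ≤ a (a superharmonic operator for Φ_T). Then D_a is positive, Ψ(D_a) ≤ D_a, and Ψⁿ(D_a) = D_{Φ_Tⁿ(a)} for every n ∈ ℕ; moreover Φ_Tⁿ(a) h → 0 as n → ∞ for every h ∈ H if and only if Ψⁿ(D_a) ξ → 0 as n → ∞ for every ξ ∈ ℓ²(W_d, H). That is, a is a pure superharmonic operator for Φ_T if and only if D_a is a pure superharmonic operator for Ψ. -/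

import Mathlib

open ContinuousLinearMap Filter

/-- `ℓ²(W_d, H)`: the Hilbert space of square-summable `H`-valued functions on the
set `W_d = List (Fin d)` of finite words in the alphabet `{1, …, d}`. -/
noncomputable abbrev FockH (d : ℕ) (H : Type*) [NormedAddCommGroup H] : Type _ :=
  lp (fun _ : List (Fin d) => H) 2

/-- The completely positive map `Φ_T(a) = ∑ i, T_i a T_i*` on `B(H)`. -/
noncomputable def PhiT {H : Type*} [NormedAddCommGroup H] [InnerProductSpace ℂ H]
    [CompleteSpace H] {d : ℕ} (T : Fin d → H →L[ℂ] H) :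
    (H →L[ℂ] H) → (H →L[ℂ] H) :=
  fun a => ∑ i, T i ∘L a ∘L adjoint (T i)

/-- The map `Ψ(b) = C* ∘ b ∘ C` on `B(ℓ²(W_d, H))` determined by an operator `C`. -/
noncomputable def PsiC {d : ℕ} {H : Type*} [NormedAddCommGroup H] [InnerProductSpace ℂ H]
    [CompleteSpace H] (C : FockH d H →L[ℂ] FockH d H) :
    (FockH d H →L[ℂ] FockH d H) → (FockH d H →L[ℂ] FockH d H) :=
  fun b => adjoint C ∘L b ∘L C

/-- Summing over words by splitting off the last letter. -/
theorem hasSum_list_of_append_singleton {d : ℕ} {E : Type*} [NormedAddCommGroup E]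
    {f : List (Fin d) → E} {s : E} (h0 : f [] = 0) (hf : HasSum f s) :
    HasSum (fun p : List (Fin d) × Fin d => f (p.1 ++ [p.2])) s := by
  have hinj : Function.Injective (fun p : List (Fin d) × Fin d => p.1 ++ [p.2]) := by
    rintro ⟨u, i⟩ ⟨v, j⟩ h
    obtain ⟨h1, h2⟩ := List.append_inj' h rfl
    simp_all
  refine (hinj.hasSum_iff ?_).2 hf
  intro w hw
  rcases List.eq_nil_or_concat w with rfl | ⟨u, i, rfl⟩
  · exact h0
  · exact absurd ⟨(u, i), by simp⟩ hw

theorem PhiT_nonneg {H : Type*} [NormedAddCommGroup H] [InnerProductSpace ℂ H]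
    [CompleteSpace H] {d : ℕ} (T : Fin d → H →L[ℂ] H) {a : H →L[ℂ] H} (ha : 0 ≤ a) :
    0 ≤ PhiT T a := by
  refine Finset.sum_nonneg fun i _ => ?_
  rw [nonneg_iff_isPositive] at ha ⊢
  exact ha.conj_adjoint (T i)

theorem PhiT_sub {H : Type*} [NormedAddCommGroup H] [InnerProductSpace ℂ H]
    [CompleteSpace H] {d : ℕ} (T : Fin d → H →L[ℂ] H) (a b : H →L[ℂ] H) :
    PhiT T (a - b) = PhiT T a - PhiT T b := by
  simp [PhiT, comp_sub, sub_comp, Finset.sum_sub_distrib]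

theorem PhiT_iterate_nonneg_and_le {H : Type*} [NormedAddCommGroup H] [InnerProductSpace ℂ H]
    [CompleteSpace H] {d : ℕ} (T : Fin d → H →L[ℂ] H) {a : H →L[ℂ] H} (ha : 0 ≤ a)
    (hsup : PhiT T a ≤ a) (n : ℕ) :
    0 ≤ (PhiT T)^[n] a ∧ (PhiT T)^[n] a ≤ a := by
  induction n with
  | zero => exact ⟨ha, le_rfl⟩
  | succ n ih =>
    rw [Function.iterate_succ_apply']
    refine ⟨PhiT_nonneg T ih.1, le_trans ?_ hsup⟩
    rw [← sub_nonneg, ← PhiT_sub]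
    exact PhiT_nonneg T (sub_nonneg.2 ih.2)

/-- A diagonal operator with positive entry is positive. -/
theorem diagonal_nonneg {d : ℕ} {H : Type*} [NormedAddCommGroup H] [InnerProductSpace ℂ H]
    [CompleteSpace H] {a : H →L[ℂ] H} (ha : 0 ≤ a) {b : FockH d H →L[ℂ] FockH d H}
    (hb : ∀ (ξ : FockH d H) (w : List (Fin d)), b ξ w = a (ξ w)) : 0 ≤ b := by
  rw [nonneg_iff_isPositive] at ha ⊢
  refine ⟨fun ξ η => ?_, fun ξ => ?_⟩
  · refine (lp.hasSum_inner (𝕜 := ℂ) (b ξ) η).unique ?_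
    refine (lp.hasSum_inner (𝕜 := ℂ) ξ (b η)).congr_fun fun w => ?_
    rw [hb, hb]
    exact ha.isSymmetric _ _
  · have h := (lp.hasSum_inner (𝕜 := ℂ) (b ξ) ξ).mapL Complex.reCLM
    refine h.nonneg fun w => ?_
    have := ha.re_inner_nonneg_left (ξ w)
    simpa [hb] using this

/-- Conjugating `I ⊗ a` by the reconstruction operator yields `I ⊗ Φ_T(a)`. -/
theorem PsiC_diagonal {d : ℕ} {H : Type*} [NormedAddCommGroup H] [InnerProductSpace ℂ H]
    [CompleteSpace H] (T : Fin d → H →L[ℂ] H) (C : FockH d H →L[ℂ] FockH d H)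
    (hC1 : ∀ (ξ : FockH d H) (w : List (Fin d)) (i : Fin d),
      C ξ (w ++ [i]) = adjoint (T i) (ξ w))
    (hC2 : ∀ ξ : FockH d H, C ξ ([] : List (Fin d)) = 0)
    (D : (H →L[ℂ] H) → (FockH d H →L[ℂ] FockH d H))
    (hD : ∀ (a : H →L[ℂ] H) (ξ : FockH d H) (w : List (Fin d)), D a ξ w = a (ξ w))
    (a : H →L[ℂ] H) : PsiC C (D a) = D (PhiT T a) := by
  refine ContinuousLinearMap.ext fun η => ext_inner_left ℂ fun ξ => ?_
  have h1 := hasSum_list_of_append_singleton (by simp [hC2])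
    (lp.hasSum_inner (𝕜 := ℂ) (C ξ) (D a (C η)))
  have h2 := h1.prod_fiberwise fun w => hasSum_fintype _
  have h3 : inner ℂ ξ (PsiC C (D a) η) = inner ℂ (C ξ) (D a (C η)) := by
    simp [PsiC, adjoint_inner_right]
  rw [h3]
  refine h2.unique ?_
  refine (lp.hasSum_inner (𝕜 := ℂ) ξ (D (PhiT T a) η)).congr_fun fun w => ?_
  simp [hD, hC1, PhiT, inner_sum, adjoint_inner_left, sum_apply]

/-- A bounded, strongly null sequence stays strongly null after tensoring with the identity. -/
theorem tendsto_diagonal_apply_zero {d : ℕ} {H : Type*} [NormedAddCommGroup H]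
    [InnerProductSpace ℂ H] {b : ℕ → H →L[ℂ] H} {B : ℕ → FockH d H →L[ℂ] FockH d H}
    (hB : ∀ (n : ℕ) (ξ : FockH d H) (w : List (Fin d)), B n ξ w = b n (ξ w))
    {M : ℝ} (hM : ∀ n, ‖b n‖ ≤ M) (hb : ∀ h, Tendsto (fun n => b n h) atTop (nhds 0))
    (ξ : FockH d H) : Tendsto (fun n => B n ξ) atTop (nhds 0) := by
  have norm_sq (η : FockH d H) : HasSum (fun w => ‖η w‖ ^ 2) (‖η‖ ^ 2) := by
    simpa using lp.hasSum_norm (p := 2) (by simp) η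
  have key : Tendsto (fun n => ∑' w, ‖B n ξ w‖ ^ 2) atTop (nhds (∑' _ : List (Fin d), (0 : ℝ))) := by
    refine tendsto_tsum_of_dominated_convergence
      ((norm_sq ξ).summable.mul_left (M ^ 2)) (fun w => ?_) (.of_forall fun n w => ?_)
    · simpa [hB] using ((hb (ξ w)).norm).pow 2
    · rw [hB, Real.norm_of_nonneg (by positivity), ← mul_pow]
      gcongr
      exact (b n).le_of_opNorm_le (hM n) _
  rw [tendsto_zero_iff_norm_tendsto_zero]
  have := key.sqrt
  simpa [fun n => (norm_sq (B n ξ)).tsum_eq] using this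

/-- Let `∑ T_i T_i* ≤ I`, let `C` be the reconstruction operator of `T`, let
`Φ_T(a) = ∑ T_i a T_i*` and `Ψ(b) = C* b C`, and let `D : a ↦ D_a = I ⊗ a` be the
diagonal embedding `B(H) → B(ℓ²(W_d, H))`.  If `a ≥ 0` is superharmonic for `Φ_T`
(`Φ_T(a) ≤ a`), then `D_a ≥ 0` is superharmonic for `Ψ`, `Ψⁿ(D_a) = D_{Φ_Tⁿ(a)}`
for every `n`, and `Φ_Tⁿ(a) → 0` strongly iff `Ψⁿ(D_a) → 0` strongly; i.e. `a` is
pure superharmonic for `Φ_T` iff `D_a` is pure superharmonic for `Ψ`. -/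
theorem pure_superharmonic_iff_diagonal_pure_superharmonic
    {H : Type*} [NormedAddCommGroup H] [InnerProductSpace ℂ H] [CompleteSpace H]
    {d : ℕ} (hd : 0 < d) (T : Fin d → H →L[ℂ] H)
    (hT : ∑ i, T i ∘L adjoint (T i) ≤ 1)
    (C : FockH d H →L[ℂ] FockH d H)
    (hC1 : ∀ (ξ : FockH d H) (w : List (Fin d)) (i : Fin d),
      C ξ (w ++ [i]) = adjoint (T i) (ξ w))
    (hC2 : ∀ ξ : FockH d H, C ξ ([] : List (Fin d)) = 0)
    (D : (H →L[ℂ] H) → (FockH d H →L[ℂ] FockH d H))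
    (hD : ∀ (a : H →L[ℂ] H) (ξ : FockH d H) (w : List (Fin d)), D a ξ w = a (ξ w))
    (a : H →L[ℂ] H) (ha : 0 ≤ a) (hsup : PhiT T a ≤ a) :
    0 ≤ D a ∧
    PsiC C (D a) ≤ D a ∧
    (∀ n : ℕ, (PsiC C)^[n] (D a) = D ((PhiT T)^[n] a)) ∧
    ((∀ h : H, Tendsto (fun n : ℕ => ((PhiT T)^[n] a) h) atTop (nhds 0)) ↔
      (∀ ξ : FockH d H,
        Tendsto (fun n : ℕ => ((PsiC C)^[n] (D a)) ξ) atTop (nhds 0))) := by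
  have hiter (n : ℕ) : (PsiC C)^[n] (D a) = D ((PhiT T)^[n] a) := by
    induction n with
    | zero => rfl
    | succ n ih =>
      rw [Function.iterate_succ_apply', Function.iterate_succ_apply', ih,
        PsiC_diagonal T C hC1 hC2 D hD]
  refine ⟨diagonal_nonneg ha (hD a), ?_, hiter, fun h ξ => ?_, fun h x => ?_⟩
  · rw [PsiC_diagonal T C hC1 hC2 D hD, ← sub_nonneg]
    exact diagonal_nonneg (sub_nonneg.2 hsup) fun ξ w => by simp [hD]
  · simp only [hiter]
    refine tendsto_diagonal_apply_zero (fun n => hD _) (M := ‖a‖) (fun n => ?_) h ξ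
    obtain ⟨h0, hle⟩ := PhiT_iterate_nonneg_and_le T ha hsup n
    exact CStarAlgebra.norm_le_norm_of_nonneg_of_le h0 hle
  · have hx := h (lp.single 2 ([] : List (Fin d)) x)
    simp only [hiter] at hx
    rw [tendsto_zero_iff_norm_tendsto_zero] at hx ⊢
    refine squeeze_zero (fun _ => norm_nonneg _) (fun n => ?_) hx
    have := lp.norm_apply_le_norm (two_ne_zero)
      (D ((PhiT T)^[n] a) (lp.single 2 ([] : List (Fin d)) x)) []
    simpa [hD] using this
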